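/- arXiv:2602.01001 — 6 statements merged into one kernel-verified Lean document; each statement's English description precedes it below -/
import Mathlib

section
/- Let d1 and d2 be positive integers with d1 ≥ 3, 3 ∣ d1, d2 ≥ 2, 2 ∣ d2, and gcd(d1, d2) = 1. Let m be an odd positive integer, and let a and b be integers with a ≡ 1 (mod 12) and b = 2^{d1}·a − 3^m. Then there are no integers x, y, z with x even satisfying a·x^{d1} − y^{d2} − z² + x·y·z − b = 0. -/
theorem ZMod.isIdempotentElem_sq_four (y : ZMod 4) : IsIdempotentElem (y ^ 2) := by
  unfold IsIdempotentElem
  revert y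
  decide

theorem ZMod.pow_eq_sq_four {d : ℕ} (hd : Even d) (h0 : d ≠ 0) (y : ZMod 4) :
    y ^ d = y ^ 2 := by
  obtain ⟨e, rfl⟩ := even_iff_two_dvd.mp hd
  rw [pow_mul]
  exact (ZMod.isIdempotentElem_sq_four y).pow_eq (by omega)

theorem ZMod.two_mul_pow_four (k : ZMod 4) {d : ℕ} (hd : 2 ≤ d) : (2 * k) ^ d = 0 := by
  refine pow_eq_zero_of_le hd ?_
  revert k
  decide

theorem ZMod.three_pow_odd_four {m : ℕ} (hm : Odd m) : (3 : ZMod 4) ^ m = 3 := by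
  rw [show (3 : ZMod 4) = -1 by decide, hm.neg_one_pow]

theorem fruit_diophantine_no_even_x_solution
    (d1 d2 : ℕ) (hd1 : 3 ≤ d1) (hd1' : 3 ∣ d1) (hd2 : 2 ≤ d2) (hd2' : 2 ∣ d2)
    (hgcd : Nat.gcd d1 d2 = 1)
    (m : ℕ) (hm : Odd m) (hm' : 0 < m)
    (a b : ℤ) (ha : a % 12 = 1) (hb : b = 2 ^ d1 * a - 3 ^ m) :
    ¬ ∃ x y z : ℤ, Even x ∧ a * x ^ d1 - y ^ d2 - z ^ 2 + x * y * z - b = 0 := by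
  rintro ⟨x, y, z, hx, h⟩
  obtain ⟨k, rfl⟩ := even_iff_two_dvd.mp hx
  subst hb
  have h4 := congrArg (Int.cast : ℤ → ZMod 4) h
  have h2 : (2 : ZMod 4) ^ d1 = 0 := by
    simpa using ZMod.two_mul_pow_four 1 (show 2 ≤ d1 by omega)
  push_cast at h4
  rw [ZMod.two_mul_pow_four _ (by omega), h2, ZMod.three_pow_odd_four hm,
    ZMod.pow_eq_sq_four (even_iff_two_dvd.mpr hd2') (by omega), mul_zero, zero_mul] at h4
  generalize (y : ZMod 4) = y, (z : ZMod 4) = z, (k : ZMod 4) = k at h4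
  revert y z k
  decide
end

section
/- Let d1 and d2 be positive integers with d1 ≥ 3, 3 ∣ d1, d2 ≥ 2, 2 ∣ d2, and gcd(d1, d2) = 1. Let a and b be integers with a ≡ 1 (mod 12) and b = 2^{d1}·a − 3. Then there are no integers x, y, z with x ≡ 1 (mod 12) satisfying a·x^{d1} − y^{d2} − z² + x·y·z − b = 0. -/
theorem ZMod.three_pow_even (y : ZMod 3) {k : ℕ} (hk : k ≠ 0) : y ^ (2 * k) = y ^ 2 := by
  have h : y ^ 2 = 0 ∨ y ^ 2 = 1 := by revert y; decide
  rcases h with h | h <;> simp [pow_mul, h, hk]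

theorem fruit_diophantine_no_solution_x_one_mod_twelve
    (d1 d2 : ℕ) (hd1 : 3 ≤ d1) (hd1' : 3 ∣ d1) (hd2 : 2 ≤ d2) (hd2' : 2 ∣ d2)
    (hgcd : Nat.gcd d1 d2 = 1)
    (a b : ℤ) (ha : a % 12 = 1) (hb : b = 2 ^ d1 * a - 3) :
    ¬ ∃ x y z : ℤ, x % 12 = 1 ∧ a * x ^ d1 - y ^ d2 - z ^ 2 + x * y * z - b = 0 := by
  rintro ⟨x, y, z, hx, h⟩
  have cast_eq_one (n : ℤ) (hn : n % 12 = 1) : (n : ZMod 3) = 1 := by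
    have : (n : ZMod 3) = (1 : ℤ) := (ZMod.intCast_eq_intCast_iff' n 1 3).2 (by omega)
    simpa using this
  have hodd : Odd d1 := by
    rw [← Nat.not_even_iff_odd, even_iff_two_dvd]
    intro h2
    have := Nat.dvd_gcd h2 hd2'
    omega
  obtain ⟨k, rfl⟩ := hd2'
  have two_pow : (2 : ZMod 3) ^ d1 = 2 := by
    rw [show (2 : ZMod 3) = -1 by decide, hodd.neg_one_pow]
  have h3 := congrArg (Int.cast : ℤ → ZMod 3) h
  rw [hb] at h3
  push_cast at h3
  rw [cast_eq_one a ha, cast_eq_one x hx, ZMod.three_pow_even _ (by omega), two_pow, one_pow] at h3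
  generalize (y : ZMod 3) = u at h3
  generalize (z : ZMod 3) = v at h3
  revert u v
  decide
end

section
/- Let d1 and d2 be positive integers with d1 ≥ 3, 3 ∣ d1, d2 ≥ 2, 2 ∣ d2, and gcd(d1, d2) = 1. Let a and b be integers with a ≡ 1 (mod 12) and b = 2^{d1}·a − 3. If integers x, y, z with x odd satisfy a·x^{d1} − y^{d2} − z² + x·y·z − b = 0, then y is even, z is even, and x ≡ 1 (mod 4). -/
theorem Int.odd_pow_modEq_self_four {x : ℤ} (hx : Odd x) {n : ℕ} (hn : Odd n) :
    x ^ n ≡ x [ZMOD 4] := by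
  obtain ⟨k, rfl⟩ := hn
  have hsq : x ^ 2 ≡ 1 [ZMOD 4] :=
    (Int.sq_mod_four_eq_one_of_odd hx).trans (by norm_num)
  simpa only [pow_succ (n := 2 * k), pow_mul, one_pow, one_mul] using
    (hsq.pow k).mul_right x

theorem Even.four_dvd_pow {y : ℤ} (hy : Even y) {n : ℕ} (hn : 2 ≤ n) : 4 ∣ y ^ n :=
  (pow_dvd_pow_of_dvd hy.two_dvd 2).trans (pow_dvd_pow y hn)

theorem fruit_diophantine_odd_x_consequences
    (d1 d2 : ℕ) (hd1 : 3 ≤ d1) (hd1' : 3 ∣ d1) (hd2 : 2 ≤ d2) (hd2' : 2 ∣ d2)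
    (hgcd : Nat.gcd d1 d2 = 1)
    (a b : ℤ) (ha : a % 12 = 1) (hb : b = 2 ^ d1 * a - 3)
    (x y z : ℤ) (hx : Odd x)
    (heq : a * x ^ d1 - y ^ d2 - z ^ 2 + x * y * z - b = 0) :
    Even y ∧ Even z ∧ x % 4 = 1 := by
  have hd1_odd : Odd d1 :=
    Nat.coprime_two_right.mp (Nat.Coprime.coprime_dvd_right hd2' hgcd)
  have ha_odd : Odd a := Int.odd_iff.mpr (by lia)
  have hpow : (4 : ℤ) ∣ 2 ^ d1 * a :=
    (even_two.four_dvd_pow (by lia)).mul_right a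
  have hb4 : b % 4 = 1 := by lia
  have hb_odd : Odd b := Int.odd_iff.mpr (by lia)
  have hyz : Even y ∧ Even z := by
    have h : Even (a * x ^ d1 - y ^ d2 - z ^ 2 + x * y * z - b) := heq ▸ Even.zero
    have hd2_ne : d2 ≠ 0 := by lia
    have hax : Odd (a * x ^ d1) := ha_odd.mul hx.pow
    rw [← Int.not_even_iff_odd] at hax hb_odd hx
    simp only [Int.even_sub, Int.even_add, Int.even_mul, Int.even_pow] at h hax
    tauto
  obtain ⟨hy, hz⟩ := hyz
  have hy4 := hy.four_dvd_pow hd2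
  have hz4 := hz.four_dvd_pow le_rfl
  have hxyz : (4 : ℤ) ∣ x * y * z := by
    rw [mul_assoc]
    exact (mul_dvd_mul hy.two_dvd hz.two_dvd).mul_left x
  have hax : a * x ^ d1 ≡ x [ZMOD 4] := by
    have ha4 : a ≡ 1 [ZMOD 4] := by
      change a % 4 = 1 % 4
      lia
    simpa using ha4.mul (Int.odd_pow_modEq_self_four hx hd1_odd)
  have hax4 : a * x ^ d1 % 4 = x % 4 := hax
  refine ⟨hy, hz, ?_⟩
  omega
end

section
/- Let d1 ≥ 3 be an integer, let m be an odd positive integer, and let a be an integer with a ≡ 1 (mod 12). Then for all integers Y, Z, β, k with k odd, one has Y² − (β² − k²)·Z² ≠ k²·(a·2^{d1}·β^{d1} − a·2^{d1} + 3^m). -/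
theorem ZMod.four_two_pow_eq_zero {n : ℕ} (hn : 2 ≤ n) : (2 : ZMod 4) ^ n = 0 :=
  pow_eq_zero_of_le hn (by decide)

theorem ZMod.four_three_pow_of_odd {n : ℕ} (hn : Odd n) : (3 : ZMod 4) ^ n = 3 := by
  rw [show (3 : ZMod 4) = -1 by decide, hn.neg_one_pow]

theorem ZMod.four_intCast_sq_of_odd {k : ℤ} (hk : Odd k) : (k : ZMod 4) ^ 2 = 1 := by
  obtain ⟨t, rfl⟩ := hk
  push_cast
  generalize (t : ZMod 4) = s
  revert s
  decide

theorem ZMod.four_sq_sub_mul_sq_ne_three (y z b : ZMod 4) :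
    y ^ 2 - (b ^ 2 - 1) * z ^ 2 ≠ 3 := by
  revert y z b
  decide

theorem even_case_identity_impossible
    (d1 : ℕ) (hd1 : 3 ≤ d1)
    (m : ℕ) (hm : Odd m) (hm' : 0 < m)
    (a : ℤ) (ha : a % 12 = 1) :
    ∀ Y Z β k : ℤ, Odd k →
      Y ^ 2 - (β ^ 2 - k ^ 2) * Z ^ 2 ≠
        k ^ 2 * (a * 2 ^ d1 * β ^ d1 - a * 2 ^ d1 + 3 ^ m) := by
  intro Y Z β k hk h
  have h4 := congrArg (Int.cast : ℤ → ZMod 4) h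
  push_cast at h4
  rw [ZMod.four_intCast_sq_of_odd hk, ZMod.four_two_pow_eq_zero (by lia),
    ZMod.four_three_pow_of_odd hm] at h4
  exact ZMod.four_sq_sub_mul_sq_ne_three Y Z β (by simpa using h4)
end

section
/- For every nonzero integer y, the divisibility y^{14} ∣ (100·y³ + 681766875) holds if and only if y = 1 or y = −1. -/
theorem divisibility_y14_example2 (y : ℤ) (hy : y ≠ 0) :
    y ^ 14 ∣ (100 * y ^ 3 + 681766875) ↔ y = 1 ∨ y = -1 := by
  constructor
  · intro h
    have hne : 100 * y ^ 3 + 681766875 ≠ 0 := by omega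
    have hle : |y| ^ 14 ≤ 100 * |y| ^ 3 + 681766875 := by
      have h₁ : |y ^ 14| ≤ |100 * y ^ 3 + 681766875| :=
        Int.le_of_dvd (abs_pos.mpr hne) ((abs_dvd_abs _ _).mpr h)
      have h₂ := abs_add_le (100 * y ^ 3) 681766875
      rw [abs_mul, abs_pow] at h₂
      rw [abs_pow] at h₁
      norm_num at h₁ h₂ ⊢
      linarith
    have hlt : |y| < 5 := by
      by_contra! h5
      have h₃ : (5 : ℤ) ^ 3 ≤ |y| ^ 3 := by gcongr
      have h₁₁ : (5 : ℤ) ^ 11 ≤ |y| ^ 11 := by gcongr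
      have hmul : (5 : ℤ) ^ 11 * |y| ^ 3 ≤ |y| ^ 11 * |y| ^ 3 := by gcongr
      rw [← pow_add] at hmul
      norm_num at h₃ hmul
      linarith
    obtain ⟨hl, hu⟩ := abs_lt.mp hlt
    clear hle hlt hne
    interval_cases y <;> revert hy h <;> norm_num
  · rintro (rfl | rfl) <;> norm_num
end

section
/- For every nonzero integer y, the divisibility y^{10} ∣ (148·y³ + 3194933868) holds if and only if y = 1 or y = −1. -/
theorem divisibility_y10_example3 (y : ℤ) (hy : y ≠ 0) :
    y ^ 10 ∣ (148 * y ^ 3 + 3194933868) ↔ y = 1 ∨ y = -1 := by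
  constructor
  · intro h
    have hne : 148 * y ^ 3 + 3194933868 ≠ 0 := by
      intro h0
      rcases le_or_gt y (-279) with h1 | h1
      · have := (Odd.strictMono_pow (R := ℤ) (n := 3) (by decide)).monotone h1
        norm_num at this
        linarith
      · have h2 : (-278 : ℤ) ≤ y := by omega
        have := (Odd.strictMono_pow (R := ℤ) (n := 3) (by decide)).monotone h2
        norm_num at this
        linarith
    have hle : |y| ^ 10 ≤ 148 * |y| ^ 3 + 3194933868 := by
      have hdvd := Int.le_of_dvd (abs_pos.mpr hne) ((abs_dvd_abs _ _).mpr h)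
      have htri := abs_add_le (148 * y ^ 3) 3194933868
      simp only [abs_mul, abs_pow, Nat.abs_ofNat] at hdvd htri
      exact hdvd.trans htri
    have hlt : |y| < 9 := by
      by_contra! h9
      have h3 : (9 : ℤ) ^ 3 ≤ |y| ^ 3 := by gcongr
      have h7 : (9 : ℤ) ^ 7 ≤ |y| ^ 7 := by gcongr
      have hmul := mul_le_mul_of_nonneg_right h7 (by positivity : 0 ≤ |y| ^ 3)
      have hpow : |y| ^ 7 * |y| ^ 3 = |y| ^ 10 := by ring
      linarith
    obtain ⟨hlo, hhi⟩ := abs_lt.mp hlt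
    clear hle hlt hne
    interval_cases y <;> first | omega | (norm_num at h)
  · rintro (rfl | rfl) <;> norm_num
end
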